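/- (Set-level Kashiwara involution on intersections of semi-infinite cells.) For every γ ∈ ℤⁿ, the map L ↦ t^γ · ψ(L) on Gr (where ψ acts by [g] ↦ [(gᵀ)⁻¹] and t^γ acts by left multiplication) is an involution of Gr that maps the set S^0 ∩ T^γ bijectively onto itself. -/

import Mathlib

open scoped Pointwise

set_option synthInstance.maxHeartbeats 1000000
set_option maxHeartbeats 1000000

noncomputable section

abbrev Kfld : Type := LaurentSeries ℂ

def Oring : Subring Kfld := (HahnSeries.ofPowerSeries ℤ ℂ).range

def tK : Kfld := HahnSeries.single (1 : ℤ) 1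

lemma tK_ne_zero : tK ≠ 0 := HahnSeries.single_ne_zero one_ne_zero

abbrev GLn (n : ℕ) := Matrix.GeneralLinearGroup (Fin n) Kfld

def KSub (n : ℕ) : Subgroup (GLn n) where
  carrier := {g | (∀ i j, (g : Matrix (Fin n) (Fin n) Kfld) i j ∈ Oring) ∧
      (∀ i j, ((g⁻¹ : GLn n) : Matrix (Fin n) (Fin n) Kfld) i j ∈ Oring)}
  one_mem' := by
    refine ⟨fun i j => ?_, fun i j => ?_⟩ <;>
      simp only [inv_one, Units.val_one, Matrix.one_apply] <;>
      split <;> first | exact one_mem _ | exact zero_mem _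
  mul_mem' := by
    rintro a b ⟨ha1, ha2⟩ ⟨hb1, hb2⟩
    refine ⟨fun i j => ?_, fun i j => ?_⟩
    · rw [Units.val_mul, Matrix.mul_apply]
      exact Subring.sum_mem _ fun k _ => mul_mem (ha1 i k) (hb1 k j)
    · rw [mul_inv_rev, Units.val_mul, Matrix.mul_apply]
      exact Subring.sum_mem _ fun k _ => mul_mem (hb2 i k) (ha2 k j)
  inv_mem' := by
    rintro a ⟨h1, h2⟩
    exact ⟨h2, by simpa using h1⟩

lemma mem_KSub {n : ℕ} (g : GLn n) :
    g ∈ KSub n ↔ (∀ i j, (g : Matrix (Fin n) (Fin n) Kfld) i j ∈ Oring) ∧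
      (∀ i j, ((g⁻¹ : GLn n) : Matrix (Fin n) (Fin n) Kfld) i j ∈ Oring) := Iff.rfl

abbrev Gr (n : ℕ) := GLn n ⧸ KSub n

def Dominant {n : ℕ} (lam : Fin n → ℤ) : Prop := ∀ i j : Fin n, i ≤ j → lam j ≤ lam i

def tPow (n : ℕ) (lam : Fin n → ℤ) : GLn n where
  val := Matrix.diagonal fun i => tK ^ lam i
  inv := Matrix.diagonal fun i => tK ^ (-lam i)
  val_inv := by
    have h : (fun i => tK ^ lam i * tK ^ (-lam i)) = fun _ : Fin n => (1 : Kfld) := by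
      funext i; rw [← zpow_add₀ tK_ne_zero]; simp
    rw [Matrix.diagonal_mul_diagonal, h, Matrix.diagonal_one]
  inv_val := by
    have h : (fun i => tK ^ (-lam i) * tK ^ lam i) = fun _ : Fin n => (1 : Kfld) := by
      funext i; rw [← zpow_add₀ tK_ne_zero]; simp
    rw [Matrix.diagonal_mul_diagonal, h, Matrix.diagonal_one]

def lamStar {n : ℕ} (lam : Fin n → ℤ) : Fin n → ℤ := fun i => -lam i.rev

def dcoset (n : ℕ) (lam : Fin n → ℤ) : Set (GLn n) :=
  {g | ∃ k₁ ∈ KSub n, ∃ k₂ ∈ KSub n, g = k₁ * tPow n lam * k₂}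

def transGL {n : ℕ} (g : GLn n) : GLn n where
  val := (g : Matrix (Fin n) (Fin n) Kfld).transpose
  inv := ((g⁻¹ : GLn n) : Matrix (Fin n) (Fin n) Kfld).transpose
  val_inv := by
    rw [← Matrix.transpose_mul, Units.inv_mul, Matrix.transpose_one]
  inv_val := by
    rw [← Matrix.transpose_mul, Units.mul_inv, Matrix.transpose_one]

/-- `ψ(g) = (gᵀ)⁻¹`, the inverse-transpose map, as a map `GLn → GLn`. -/
def psiGL {n : ℕ} (g : GLn n) : GLn n := (transGL g)⁻¹

lemma transGL_mul {n : ℕ} (a b : GLn n) : transGL (a * b) = transGL b * transGL a :=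
  Units.ext (Matrix.transpose_mul (a : Matrix (Fin n) (Fin n) Kfld)
    (b : Matrix (Fin n) (Fin n) Kfld))

lemma transGL_inv {n : ℕ} (a : GLn n) : transGL a⁻¹ = (transGL a)⁻¹ :=
  Units.ext (by simp [transGL])

lemma transGL_mem {n : ℕ} {g : GLn n} (hg : g ∈ KSub n) : transGL g ∈ KSub n := by
  rw [mem_KSub] at hg ⊢
  refine ⟨fun i j => hg.1 j i, fun i j => ?_⟩
  have h : ((transGL g)⁻¹ : GLn n) = transGL g⁻¹ := (transGL_inv g).symm
  rw [h]
  exact hg.2 j i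

lemma psiGL_mem {n : ℕ} {g : GLn n} (hg : g ∈ KSub n) : psiGL g ∈ KSub n :=
  (KSub n).inv_mem (transGL_mem hg)

/-- The involution of the affine Grassmannian induced by `ψ`, `[g] ↦ [ψ(g)]`. -/
def PsiGr (n : ℕ) : Gr n → Gr n :=
  Quotient.map' psiGL (by
    intro a b hab
    rw [QuotientGroup.leftRel_apply] at hab ⊢
    have key : (psiGL a)⁻¹ * psiGL b = transGL (b⁻¹ * a) := by
      rw [psiGL, psiGL, inv_inv, ← transGL_inv, ← transGL_mul]
    rw [key, show b⁻¹ * a = (a⁻¹ * b)⁻¹ by rw [mul_inv_rev, inv_inv]]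
    exact transGL_mem ((KSub n).inv_mem hab))

lemma PsiGr_mk {n : ℕ} (g : GLn n) :
    PsiGr n (QuotientGroup.mk g) = QuotientGroup.mk (psiGL g) := rfl

/-- Upper unitriangular matrices. -/
def UpperUni {n : ℕ} (M : Matrix (Fin n) (Fin n) Kfld) : Prop :=
  (∀ i, M i i = 1) ∧ ∀ i j : Fin n, j < i → M i j = 0

/-- Lower unitriangular matrices. -/
def LowerUni {n : ℕ} (M : Matrix (Fin n) (Fin n) Kfld) : Prop :=
  (∀ i, M i i = 1) ∧ ∀ i j : Fin n, i < j → M i j = 0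

/-- The semi-infinite cell `S^μ = N(𝒦) t^μ ⊆ Gr`. -/
def Scell (n : ℕ) (mu : Fin n → ℤ) : Set (Gr n) :=
  {L | ∃ g : GLn n, UpperUni (g : Matrix (Fin n) (Fin n) Kfld) ∧
    L = QuotientGroup.mk (g * tPow n mu)}

/-- The opposite semi-infinite cell `T^μ = N₋(𝒦) t^μ ⊆ Gr`. -/
def Tcell (n : ℕ) (mu : Fin n → ℤ) : Set (Gr n) :=
  {L | ∃ g : GLn n, LowerUni (g : Matrix (Fin n) (Fin n) Kfld) ∧
    L = QuotientGroup.mk (g * tPow n mu)}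

lemma psiGL_mul {n : ℕ} (a b : GLn n) : psiGL (a * b) = psiGL a * psiGL b := by
  rw [psiGL, transGL_mul, mul_inv_rev, psiGL, psiGL]

lemma psiGL_psiGL {n : ℕ} (g : GLn n) : psiGL (psiGL g) = g := by
  rw [psiGL, psiGL, transGL_inv, inv_inv]
  exact Units.ext (Matrix.transpose_transpose _)

lemma psiGL_tPow (n : ℕ) (mu : Fin n → ℤ) : psiGL (tPow n mu) = (tPow n mu)⁻¹ :=
  congrArg (·⁻¹) (Units.ext (Matrix.diagonal_transpose _))

lemma tPow_zero (n : ℕ) : tPow n 0 = 1 :=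
  Units.ext (by simp [tPow])

lemma tPow_conj_apply {n : ℕ} (mu : Fin n → ℤ) (g : GLn n) (i j : Fin n) :
    ((tPow n mu * g * (tPow n mu)⁻¹ : GLn n) : Matrix (Fin n) (Fin n) Kfld) i j =
      tK ^ mu i * (g : Matrix (Fin n) (Fin n) Kfld) i j * tK ^ (-mu j) := by
  change (Matrix.diagonal (fun i => tK ^ mu i) * (g : Matrix (Fin n) (Fin n) Kfld) *
    Matrix.diagonal (fun i => tK ^ (-mu i))) i j = _
  rw [Matrix.mul_diagonal, Matrix.diagonal_mul]

lemma tPow_conj_apply_self {n : ℕ} (mu : Fin n → ℤ) (g : GLn n) (i : Fin n) :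
    ((tPow n mu * g * (tPow n mu)⁻¹ : GLn n) : Matrix (Fin n) (Fin n) Kfld) i i =
      (g : Matrix (Fin n) (Fin n) Kfld) i i := by
  rw [tPow_conj_apply, mul_right_comm, ← zpow_add₀ tK_ne_zero, add_neg_cancel, zpow_zero, one_mul]

lemma UpperUni.tPow_conj {n : ℕ} {g : GLn n}
    (hg : UpperUni (g : Matrix (Fin n) (Fin n) Kfld)) (mu : Fin n → ℤ) :
    UpperUni ((tPow n mu * g * (tPow n mu)⁻¹ : GLn n) : Matrix (Fin n) (Fin n) Kfld) :=
  ⟨fun i => by rw [tPow_conj_apply_self, hg.1], fun i j hij => by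
    rw [tPow_conj_apply, hg.2 i j hij, mul_zero, zero_mul]⟩

lemma LowerUni.tPow_conj {n : ℕ} {g : GLn n}
    (hg : LowerUni (g : Matrix (Fin n) (Fin n) Kfld)) (mu : Fin n → ℤ) :
    LowerUni ((tPow n mu * g * (tPow n mu)⁻¹ : GLn n) : Matrix (Fin n) (Fin n) Kfld) :=
  ⟨fun i => by rw [tPow_conj_apply_self, hg.1], fun i j hij => by
    rw [tPow_conj_apply, hg.2 i j hij, mul_zero, zero_mul]⟩

lemma UpperUni.inv {n : ℕ} {g : GLn n} (hg : UpperUni (g : Matrix (Fin n) (Fin n) Kfld)) :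
    UpperUni ((g⁻¹ : GLn n) : Matrix (Fin n) (Fin n) Kfld) := by
  have hz : ∀ i j : Fin n, j < i →
      ((g⁻¹ : GLn n) : Matrix (Fin n) (Fin n) Kfld) i j = 0 := by
    have hb : Matrix.BlockTriangular (g : Matrix (Fin n) (Fin n) Kfld) id :=
      fun i j hij => hg.2 i j hij
    have : Invertible (g : Matrix (Fin n) (Fin n) Kfld) := g.isUnit.invertible
    have h := Matrix.blockTriangular_inv_of_blockTriangular hb
    rw [← Matrix.coe_units_inv] at h
    exact fun i j hij => h hij
  refine ⟨fun i => ?_, hz⟩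
  have h : ((g * g⁻¹ : GLn n) : Matrix (Fin n) (Fin n) Kfld) i i = 1 := by
    rw [mul_inv_cancel, Units.val_one, Matrix.one_apply_eq]
  rw [Units.val_mul, Matrix.mul_apply, Finset.sum_eq_single i, hg.1, one_mul] at h
  · exact h
  · intro j _ hj
    rcases lt_or_gt_of_ne hj with hlt | hgt
    · rw [hg.2 i j hlt, zero_mul]
    · rw [hz j i hgt, mul_zero]
  · exact fun hi => absurd (Finset.mem_univ i) hi

lemma UpperUni.psiGL {n : ℕ} {g : GLn n} (hg : UpperUni (g : Matrix (Fin n) (Fin n) Kfld)) :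
    LowerUni ((_root_.psiGL g : GLn n) : Matrix (Fin n) (Fin n) Kfld) := by
  rw [_root_.psiGL, ← transGL_inv]
  exact ⟨hg.inv.1, fun i j hij => hg.inv.2 j i hij⟩

lemma LowerUni.psiGL {n : ℕ} {g : GLn n} (hg : LowerUni (g : Matrix (Fin n) (Fin n) Kfld)) :
    UpperUni ((_root_.psiGL g : GLn n) : Matrix (Fin n) (Fin n) Kfld) :=
  UpperUni.inv (g := transGL g) ⟨hg.1, fun i j hij => hg.2 j i hij⟩

lemma tPow_smul_PsiGr_mk {n : ℕ} (gam : Fin n → ℤ) (g : GLn n) :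
    tPow n gam • PsiGr n (QuotientGroup.mk g) = QuotientGroup.mk (tPow n gam * psiGL g) := rfl

lemma tPow_smul_PsiGr_involutive {n : ℕ} (gam : Fin n → ℤ) :
    Function.Involutive fun L : Gr n => tPow n gam • PsiGr n L := by
  intro L
  induction L using QuotientGroup.induction_on with
  | H g =>
    simp only [tPow_smul_PsiGr_mk]
    rw [psiGL_mul, psiGL_psiGL, psiGL_tPow, mul_inv_cancel_left]

lemma mapsTo_Scell_Tcell {n : ℕ} (gam : Fin n → ℤ) :
    Set.MapsTo (fun L : Gr n => tPow n gam • PsiGr n L) (Scell n 0) (Tcell n gam) := by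
  rintro _ ⟨g, hg, rfl⟩
  refine ⟨_, hg.psiGL.tPow_conj gam, ?_⟩
  simp only [tPow_smul_PsiGr_mk]
  rw [tPow_zero, mul_one, inv_mul_cancel_right]

lemma mapsTo_Tcell_Scell {n : ℕ} (gam : Fin n → ℤ) :
    Set.MapsTo (fun L : Gr n => tPow n gam • PsiGr n L) (Tcell n gam) (Scell n 0) := by
  rintro _ ⟨g, hg, rfl⟩
  refine ⟨_, hg.psiGL.tPow_conj gam, ?_⟩
  simp only [tPow_smul_PsiGr_mk]
  rw [tPow_zero, mul_one, psiGL_mul, psiGL_tPow, mul_assoc]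

theorem statement12 (n : ℕ) (gam : Fin n → ℤ) :
    (∀ L : Gr n, tPow n gam • PsiGr n (tPow n gam • PsiGr n L) = L) ∧
    Set.BijOn (fun L : Gr n => tPow n gam • PsiGr n L)
      (Scell n 0 ∩ Tcell n gam) (Scell n 0 ∩ Tcell n gam) := by
  have hinv := tPow_smul_PsiGr_involutive gam
  have hmaps : Set.MapsTo (fun L : Gr n => tPow n gam • PsiGr n L)
      (Scell n 0 ∩ Tcell n gam) (Scell n 0 ∩ Tcell n gam) :=
    fun _ hL => ⟨mapsTo_Tcell_Scell gam hL.2, mapsTo_Scell_Tcell gam hL.1⟩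
  exact ⟨hinv, hmaps, hinv.injective.injOn, fun L hL => ⟨_, hmaps hL, hinv L⟩⟩

end
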